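/- Let A : [0,1] → Fin m → Fin m → ℝ be a family of two-player zero-sum m×m payoff matrices such that A(λ) i j ∈ [0,1] for all λ, i, j, and such that for every pair (i,j) the map λ ↦ A(λ) i j is continuous on [0,1]. Let s* : [0,1] → (probability simplex on Fin m) be a measurable map such that for every λ the strategy s*(λ) is a maximin (Nash equilibrium) row strategy of A(λ), i.e., inf over column mixed strategies y of u(A(λ), s*(λ), y) = v(A(λ)). Fix λ* ∈ [0,1]. For t ≥ 1, let λ_1, …, λ_t be independent uniform random samples from [0,1], let i* be the smallest index minimizing |λ* − λ_i| over i ∈ {1, …, t}, and let ε_t be the exploitability of s*(λ_{i*}) in the game A(λ*), i.e., ε_t = v(A(λ*)) − inf over column mixed strategies y of u(A(λ*), s*(λ_{i*}), y). Assuming the map (λ_1, …, λ_t) ↦ ε_t is measurable, the expected exploitability tends to zero: lim_{t → ∞} E[ε_t] = 0. -/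

import Mathlib

open Set MeasureTheory Filter

/-- Expected payoff to the row player in a two-player zero-sum game with payoff
matrix `A`, when the row player plays mixed strategy `x` and the column player
plays mixed strategy `y`. -/
noncomputable def payoff {m k : ℕ} (A : Fin m → Fin k → ℝ)
    (x : Fin m → ℝ) (y : Fin k → ℝ) : ℝ :=
  ∑ i, ∑ j, x i * y j * A i j

/-- The value of the zero-sum game `A`: the sup over row mixed strategies of the
inf over column mixed strategies of the expected payoff. -/
noncomputable def gameValue {m k : ℕ} (A : Fin m → Fin k → ℝ) : ℝ :=
  ⨆ x : stdSimplex ℝ (Fin m), ⨅ y : stdSimplex ℝ (Fin k), payoff A x.1 y.1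

section ZeroSumGames

variable {m k : ℕ}

theorem payoff_le_payoff_add {A B : Fin m → Fin k → ℝ} {δ : ℝ}
    (hAB : ∀ i j, A i j ≤ B i j + δ) {x : Fin m → ℝ} (hx : x ∈ stdSimplex ℝ (Fin m))
    {y : Fin k → ℝ} (hy : y ∈ stdSimplex ℝ (Fin k)) :
    payoff A x y ≤ payoff B x y + δ := by
  have hδ : ∑ i, ∑ j, x i * y j * δ = δ := by
    simp_rw [← Finset.sum_mul, ← Finset.mul_sum, hy.2, mul_one, hx.2, one_mul]
  calc payoff A x y ≤ ∑ i, ∑ j, (x i * y j * B i j + x i * y j * δ) := by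
        refine Finset.sum_le_sum fun i _ => Finset.sum_le_sum fun j _ => ?_
        rw [← mul_add]
        exact mul_le_mul_of_nonneg_left (hAB i j) (mul_nonneg (hx.1 i) (hy.1 j))
    _ = payoff B x y + δ := by simp_rw [Finset.sum_add_distrib, hδ, payoff]

theorem bddBelow_range_payoff (A : Fin m → Fin k → ℝ) (x : Fin m → ℝ) :
    BddBelow (range fun y : stdSimplex ℝ (Fin k) => payoff A x y.1) := by
  have := isCompact_iff_compactSpace.mp (isCompact_stdSimplex ℝ (Fin k))
  have hcont : Continuous (payoff A x) := by unfold payoff; fun_prop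
  exact (isCompact_range (hcont.comp continuous_subtype_val)).bddBelow

theorem bddAbove_range_payoff (A : Fin m → Fin k → ℝ) (y : Fin k → ℝ) :
    BddAbove (range fun x : stdSimplex ℝ (Fin m) => payoff A x.1 y) := by
  have := isCompact_iff_compactSpace.mp (isCompact_stdSimplex ℝ (Fin m))
  have hcont : Continuous fun x => payoff A x y := by unfold payoff; fun_prop
  exact (isCompact_range (hcont.comp continuous_subtype_val)).bddAbove

theorem iInf_payoff_le_gameValue [Nonempty (stdSimplex ℝ (Fin k))] (A : Fin m → Fin k → ℝ)
    {x : Fin m → ℝ} (hx : x ∈ stdSimplex ℝ (Fin m)) :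
    ⨅ y : stdSimplex ℝ (Fin k), payoff A x y.1 ≤ gameValue A := by
  have y₀ : stdSimplex ℝ (Fin k) := Classical.arbitrary _
  exact le_ciSup (f := fun x : stdSimplex ℝ (Fin m) =>
      ⨅ y : stdSimplex ℝ (Fin k), payoff A x.1 y.1)
    ((bddAbove_range_payoff A y₀).range_mono _ fun x =>
      ciInf_le (bddBelow_range_payoff A x.1) y₀) ⟨x, hx⟩

theorem iInf_payoff_le_iInf_payoff_add [Nonempty (stdSimplex ℝ (Fin k))]
    {A B : Fin m → Fin k → ℝ} {δ : ℝ} (hAB : ∀ i j, A i j ≤ B i j + δ)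
    {x : Fin m → ℝ} (hx : x ∈ stdSimplex ℝ (Fin m)) :
    ⨅ y : stdSimplex ℝ (Fin k), payoff A x y.1 ≤
      (⨅ y : stdSimplex ℝ (Fin k), payoff B x y.1) + δ := by
  rw [← sub_le_iff_le_add]
  refine le_ciInf fun y => ?_
  rw [sub_le_iff_le_add]
  exact (ciInf_le (bddBelow_range_payoff A x) y).trans (payoff_le_payoff_add hAB hx y.2)

theorem gameValue_le_gameValue_add [Nonempty (stdSimplex ℝ (Fin m))]
    [Nonempty (stdSimplex ℝ (Fin k))] {A B : Fin m → Fin k → ℝ} {δ : ℝ}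
    (hAB : ∀ i j, A i j ≤ B i j + δ) : gameValue A ≤ gameValue B + δ :=
  ciSup_le fun x => (iInf_payoff_le_iInf_payoff_add hAB x.2).trans
    (add_le_add_left (iInf_payoff_le_gameValue B x.2) δ)

/-- A maximin strategy of `B` has exploitability at most `2 * δ` in every game that is
entrywise within `δ` of `B`. -/
theorem exploitability_le_of_maximin [Nonempty (stdSimplex ℝ (Fin m))]
    [Nonempty (stdSimplex ℝ (Fin k))] {A B : Fin m → Fin k → ℝ} {δ : ℝ}
    (hAB : ∀ i j, |A i j - B i j| ≤ δ) {x : Fin m → ℝ} (hx : x ∈ stdSimplex ℝ (Fin m))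
    (hmax : ⨅ y : stdSimplex ℝ (Fin k), payoff B x y.1 = gameValue B) :
    gameValue A - ⨅ y : stdSimplex ℝ (Fin k), payoff A x y.1 ≤ 2 * δ := by
  have h₁ : gameValue A ≤ gameValue B + δ :=
    gameValue_le_gameValue_add fun i j => by linarith [(abs_le.mp (hAB i j)).2]
  have h₂ := iInf_payoff_le_iInf_payoff_add (A := B) (B := A) (δ := δ)
    (fun i j => by linarith [(abs_le.mp (hAB i j)).1]) hx
  linarith

end ZeroSumGames

theorem volume_Icc_diff_ball_lt_one {a r : ℝ} (ha : a ∈ Icc (0 : ℝ) 1) (hr : 0 < r) :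
    volume (Icc (0 : ℝ) 1 \ Metric.ball a r) < 1 := by
  have hne : (Metric.ball a r ∩ Ioo 0 1).Nonempty := by
    rw [← closure_Ioo (zero_ne_one' ℝ)] at ha
    exact mem_closure_iff.mp ha _ Metric.isOpen_ball (Metric.mem_ball_self hr)
  have hpos : 0 < volume (Icc (0 : ℝ) 1 ∩ Metric.ball a r) :=
    ((Metric.isOpen_ball.inter isOpen_Ioo).measure_pos volume hne).trans_le
      (measure_mono fun z hz => ⟨Ioo_subset_Icc_self hz.2, hz.1⟩)
  have hsum := measure_inter_add_sdiff (μ := volume) (Icc (0 : ℝ) 1)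
    (Metric.isOpen_ball (x := a) (ε := r)).measurableSet
  rw [Real.volume_Icc, sub_zero, ENNReal.ofReal_one] at hsum
  rw [← hsum, add_comm]
  exact ENNReal.lt_add_right (measure_ne_top_of_subset sdiff_subset (by simp)) hpos.ne'

/-- The expectation of a bounded nonnegative function of the sample nearest to `a` tends to zero
if the function tends to zero at `a`. -/
theorem tendsto_integral_nearest_sample {a : ℝ} (ha : a ∈ Icc (0 : ℝ) 1) {g : ℝ → ℝ} {C : ℝ}
    (hg0 : ∀ l ∈ Icc (0 : ℝ) 1, 0 ≤ g l) (hgC : ∀ l ∈ Icc (0 : ℝ) 1, g l ≤ C)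
    (hg : Tendsto g (nhdsWithin a (Icc 0 1)) (nhds 0))
    (I : (t : ℕ) → (Fin (t + 1) → ℝ) → Fin (t + 1))
    (hI : ∀ (t : ℕ) (lams : Fin (t + 1) → ℝ) (i : Fin (t + 1)),
      |a - lams (I t lams)| ≤ |a - lams i|) :
    Tendsto (fun t : ℕ => ∫ lams, g (lams (I t lams))
        ∂(Measure.pi fun _ : Fin (t + 1) => volume.restrict (Icc (0 : ℝ) 1)))
      atTop (nhds 0) := by
  have : IsProbabilityMeasure (volume.restrict (Icc (0 : ℝ) 1)) := ⟨by simp⟩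
  have hC : 0 ≤ C := (hg0 a ha).trans (hgC a ha)
  have hmem : ∀ t : ℕ, ∀ᵐ lams ∂(Measure.pi fun _ : Fin (t + 1) =>
      volume.restrict (Icc (0 : ℝ) 1)), ∀ i, lams i ∈ Icc (0 : ℝ) 1 := fun t =>
    eventually_all.mpr fun i =>
      (Measure.quasiMeasurePreserving_eval _ i).ae (ae_restrict_mem measurableSet_Icc)
  have hnonneg : ∀ t : ℕ, 0 ≤ᵐ[Measure.pi fun _ : Fin (t + 1) =>
      volume.restrict (Icc (0 : ℝ) 1)] fun lams => g (lams (I t lams)) := fun t => by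
    filter_upwards [hmem t] with lams hl using hg0 _ (hl _)
  rw [tendsto_order]
  refine ⟨fun b hb => Eventually.of_forall fun t =>
    hb.trans_le (integral_nonneg_of_ae (hnonneg t)), fun ε hε => ?_⟩
  obtain ⟨r, hr, hball⟩ := Metric.mem_nhdsWithin_iff.mp
    (hg.eventually (eventually_lt_nhds (half_pos hε)))
  set q := volume.real (Icc (0 : ℝ) 1 \ Metric.ball a r) with hq_def
  have hq : q < 1 := by
    have := volume_Icc_diff_ball_lt_one ha hr
    simpa [hq_def, measureReal_def] using (ENNReal.toReal_lt_toReal this.ne_top ENNReal.one_ne_top).mpr this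
  have hlim : Tendsto (fun t : ℕ => ε / 2 + C * q ^ (t + 1)) atTop (nhds (ε / 2)) := by
    simpa using (((tendsto_pow_atTop_nhds_zero_of_lt_one measureReal_nonneg hq).comp
      (tendsto_add_atTop_nat 1)).const_mul C).const_add (ε / 2)
  filter_upwards [hlim.eventually (eventually_lt_nhds (half_lt_self hε))] with t ht
  refine lt_of_le_of_lt ?_ ht
  set μ := Measure.pi fun _ : Fin (t + 1) => volume.restrict (Icc (0 : ℝ) 1)
  set N : Set (Fin (t + 1) → ℝ) := univ.pi fun _ => (Metric.ball a r)ᶜ with hN_def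
  have hN : MeasurableSet N :=
    MeasurableSet.univ_pi fun _ => Metric.isOpen_ball.measurableSet.compl
  have hμN : μ.real N = q ^ (t + 1) := by
    rw [measureReal_def, Measure.pi_pi, Finset.prod_const, Finset.card_univ, Fintype.card_fin,
      ENNReal.toReal_pow, Measure.restrict_apply Metric.isOpen_ball.measurableSet.compl,
      inter_comm, ← sdiff_eq, hq_def, measureReal_def]
  have hint : Integrable (N.indicator fun _ => C) μ := (integrable_const C).indicator hN
  calc ∫ lams, g (lams (I t lams)) ∂μ
      ≤ ∫ lams, (ε / 2 + N.indicator (fun _ => C) lams) ∂μ := by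
        refine integral_mono_of_nonneg (hnonneg t) ((integrable_const _).add hint) ?_
        filter_upwards [hmem t] with lams hl
        by_cases hlN : lams ∈ N
        · rw [indicator_of_mem hlN]
          linarith [hgC _ (hl (I t lams))]
        · rw [indicator_of_notMem hlN, add_zero]
          obtain ⟨i, hi⟩ : ∃ i, lams i ∈ Metric.ball a r := by
            simpa [hN_def, Set.mem_pi] using hlN
          refine (hball ⟨?_, hl (I t lams)⟩).le
          rw [Metric.mem_ball, dist_comm, Real.dist_eq] at hi ⊢
          exact (hI t lams i).trans_lt hi
    _ = ε / 2 + C * q ^ (t + 1) := by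
        rw [integral_add (integrable_const _) hint, integral_indicator_const _ hN, hμN]
        simp [mul_comm]

/-- Sampling convergence theorem.  For a family `A : [0,1] → `
m×m zero-sum payoff matrices with payoffs in `[0,1]`, each entry continuous in
the parameter, a measurable selection `sstar` of maximin (equilibrium) row
strategies, and a fixed parameter `lamstar ∈ [0,1]`: if from `t ≥ 1` i.i.d.
uniform samples `lams : Fin t → [0,1]` we pick the smallest index `I` minimizing
`|lamstar - lams i|` and play `sstar (lams (I lams))` in the game `A lamstar`,
then the expected exploitability `E[ε_t]` tends to `0` as `t → ∞`.
(Here the number of samples is written `t + 1` so that it is always ≥ 1.) -/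
theorem expected_exploitability_tendsto_zero
    {m : ℕ} (A : ℝ → Fin m → Fin m → ℝ)
    (hrange : ∀ lam ∈ Icc (0:ℝ) 1, ∀ (i j : Fin m), A lam i j ∈ Icc (0:ℝ) 1)
    (hcont : ∀ (i j : Fin m), ContinuousOn (fun lam => A lam i j) (Icc (0:ℝ) 1))
    (sstar : ℝ → Fin m → ℝ) (hsmeas : Measurable sstar)
    (hssimplex : ∀ lam ∈ Icc (0:ℝ) 1, sstar lam ∈ stdSimplex ℝ (Fin m))
    (hmaximin : ∀ lam ∈ Icc (0:ℝ) 1,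
      (⨅ y : stdSimplex ℝ (Fin m), payoff (A lam) (sstar lam) y.1) = gameValue (A lam))
    (lamstar : ℝ) (hlamstar : lamstar ∈ Icc (0:ℝ) 1)
    (I : (t : ℕ) → (Fin (t + 1) → ℝ) → Fin (t + 1))
    (hI : ∀ (t : ℕ) (lams : Fin (t + 1) → ℝ),
      (∀ i, |lamstar - lams (I t lams)| ≤ |lamstar - lams i|) ∧
      (∀ i, |lamstar - lams i| ≤ |lamstar - lams (I t lams)| → I t lams ≤ i))
    (epsT : (t : ℕ) → (Fin (t + 1) → ℝ) → ℝ)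
    (hepsT : ∀ (t : ℕ) (lams : Fin (t + 1) → ℝ),
      epsT t lams = gameValue (A lamstar) -
        ⨅ y : stdSimplex ℝ (Fin m), payoff (A lamstar) (sstar (lams (I t lams))) y.1)
    (hmeas : ∀ t, Measurable (epsT t)) :
    Tendsto (fun t : ℕ =>
        ∫ lams, epsT t lams
          ∂(Measure.pi fun _ : Fin (t + 1) => volume.restrict (Icc (0:ℝ) 1)))
      atTop (nhds (0:ℝ)) := by
  obtain ⟨x₀, hx₀⟩ : (stdSimplex ℝ (Fin m)).Nonempty := ⟨_, hssimplex lamstar hlamstar⟩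
  have : Nonempty (stdSimplex ℝ (Fin m)) := ⟨⟨x₀, hx₀⟩⟩
  simp_rw [hepsT]
  set g : ℝ → ℝ := fun l => gameValue (A lamstar) -
    ⨅ y : stdSimplex ℝ (Fin m), payoff (A lamstar) (sstar l) y.1 with hg_def
  have hg0 : ∀ l ∈ Icc (0 : ℝ) 1, 0 ≤ g l := fun l hl =>
    sub_nonneg.mpr (iInf_payoff_le_gameValue _ (hssimplex l hl))
  have hgle : ∀ l ∈ Icc (0 : ℝ) 1, ∀ δ, (∀ i j, |A lamstar i j - A l i j| ≤ δ) → g l ≤ 2 * δ :=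
    fun l hl δ h => exploitability_le_of_maximin h (hssimplex l hl) (hmaximin l hl)
  refine tendsto_integral_nearest_sample (g := g) (C := 2 * 1) hlamstar hg0
    (fun l hl => hgle l hl 1 fun i j => ?_) ?_ I fun t lams => (hI t lams).1
  · have h₁ := hrange lamstar hlamstar i j
    have h₂ := hrange l hl i j
    exact abs_le.mpr ⟨by linarith [h₁.1, h₂.2], by linarith [h₁.2, h₂.1]⟩
  · rw [tendsto_order]
    refine ⟨fun b hb => ?_, fun ε hε => ?_⟩
    · filter_upwards [self_mem_nhdsWithin] with l hl using hb.trans_le (hg0 l hl)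
    · have hclose : ∀ᶠ l in nhdsWithin lamstar (Icc 0 1),
          ∀ i j, |A lamstar i j - A l i j| ≤ ε / 3 := by
        refine eventually_all.mpr fun i => eventually_all.mpr fun j => ?_
        filter_upwards [Metric.tendsto_nhds.mp (hcont i j lamstar hlamstar) (ε / 3)
          (by positivity)] with l hl
        rw [dist_comm, Real.dist_eq] at hl
        exact hl.le
      filter_upwards [hclose, self_mem_nhdsWithin] with l hl hmem
      linarith [hgle l hmem _ hl]
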